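/- Let Γ be the free product (ℤ/2ℤ × ℤ/2ℤ) * (ℤ/2ℤ), with R0 and R2 the images of (1,0) and (0,1) from the first free factor and R1 the image of the generator of the second free factor. Set S = R1·R2 and S' = R0·R1·R2·R0. Then the subgroup of Γ generated by S and S' is a free group of rank 2 with free basis {S, S'} (equivalently, the homomorphism from the free group on two generators to Γ sending the two generators to S and S' is injective), and this subgroup has index 4 in Γ. -/

import Mathlib

/-- `Γ` is the free product `(ℤ/2ℤ × ℤ/2ℤ) ∗ (ℤ/2ℤ)` underlying the algebraic theory of maps. -/
abbrev Γ : Type := Monoid.Coprod (Multiplicative (ZMod 2 × ZMod 2)) (Multiplicative (ZMod 2))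

/-- `R0` is the image of `(1,0)` from the first free factor. -/
def R0 : Γ := Monoid.Coprod.inl (Multiplicative.ofAdd ((1, 0) : ZMod 2 × ZMod 2))

/-- `R1` is the image of the generator of the second free factor. -/
def R1 : Γ := Monoid.Coprod.inr (Multiplicative.ofAdd (1 : ZMod 2))

/-- `R2` is the image of `(0,1)` from the first free factor. -/
def R2 : Γ := Monoid.Coprod.inl (Multiplicative.ofAdd ((0, 1) : ZMod 2 × ZMod 2))

/-- The action of `ℤ/2 × ℤ/2` on the free group of rank two by endomorphisms: the first factor
swaps the two generators and the second inverts both of them. -/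
def swapInvEnd (v : Multiplicative (ZMod 2 × ZMod 2)) : FreeGroup (Fin 2) →* FreeGroup (Fin 2) :=
  FreeGroup.lift fun i => FreeGroup.of (if v.toAdd.1 = 0 then i else i.rev) ^ (if v.toAdd.2 = 0 then (1 : ℤ) else -1)

lemma swapInvEnd_mul (v w : Multiplicative (ZMod 2 × ZMod 2)) :
    swapInvEnd (v * w) = (swapInvEnd v).comp (swapInvEnd w) := by
  have sign (a b : ZMod 2) : (if a + b = 0 then (1 : ℤ) else -1) =
      (if a = 0 then 1 else -1) * (if b = 0 then 1 else -1) := by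
    decide +revert
  have index (i : Fin 2) (a b : ZMod 2) : (if a + b = 0 then i else i.rev) =
      if a = 0 then (if b = 0 then i else i.rev) else (if b = 0 then i else i.rev).rev := by
    decide +revert
  ext i
  simp only [swapInvEnd, FreeGroup.lift_apply_of, MonoidHom.comp_apply, map_zpow, toAdd_mul,
    Prod.fst_add, Prod.snd_add, sign, index, zpow_mul]

lemma swapInvEnd_one : swapInvEnd 1 = MonoidHom.id _ := by
  ext i
  simp only [swapInvEnd, FreeGroup.lift_apply_of, toAdd_one, Prod.fst_zero, Prod.snd_zero, if_true,
    zpow_one, MonoidHom.id_apply]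

lemma mul_self_eq_one_of_zmod_two (v : Multiplicative (ZMod 2 × ZMod 2)) : v * v = 1 := by
  decide +revert

/-- `swapInvEnd` as an action by automorphisms. -/
def swapInv : Multiplicative (ZMod 2 × ZMod 2) →* MulAut (FreeGroup (Fin 2)) where
  toFun v := MonoidHom.toMulEquiv (swapInvEnd v) (swapInvEnd v)
    (by rw [← swapInvEnd_mul, mul_self_eq_one_of_zmod_two, swapInvEnd_one])
    (by rw [← swapInvEnd_mul, mul_self_eq_one_of_zmod_two, swapInvEnd_one])
  map_one' := by
    ext x
    exact DFunLike.congr_fun swapInvEnd_one x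
  map_mul' v w := by
    ext x
    exact DFunLike.congr_fun (swapInvEnd_mul v w) x

lemma swapInv_apply_of (v : Multiplicative (ZMod 2 × ZMod 2)) (i : Fin 2) :
    swapInv v (FreeGroup.of i) =
      FreeGroup.of (if v.toAdd.1 = 0 then i else i.rev) ^ (if v.toAdd.2 = 0 then (1 : ℤ) else -1) :=
  FreeGroup.lift_apply_of

/-- The homomorphism from `ℤ/2` determined by an element squaring to one. -/
def zmodTwoLift {G : Type*} [Group G] (g : G) (hg : g * g = 1) : Multiplicative (ZMod 2) →* G where
  toFun x := if x = 1 then 1 else g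
  map_one' := if_pos rfl
  map_mul' x y := by
    have key : (x = 1 ∧ y = 1 ∧ x * y = 1) ∨ (x ≠ 1 ∧ y = 1 ∧ x * y ≠ 1) ∨
        (x = 1 ∧ y ≠ 1 ∧ x * y ≠ 1) ∨ (x ≠ 1 ∧ y ≠ 1 ∧ x * y = 1) := by
      decide +revert
    rcases key with ⟨h₁, h₂, h₃⟩ | ⟨h₁, h₂, h₃⟩ | ⟨h₁, h₂, h₃⟩ | ⟨h₁, h₂, h₃⟩ <;>
      simp only [if_pos, if_neg, h₁, h₂, h₃, hg, not_false_eq_true, mul_one, one_mul]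

lemma zmodTwoLift_ofAdd_one {G : Type*} [Group G] (g : G) (hg : g * g = 1) :
    zmodTwoLift g hg (Multiplicative.ofAdd 1) = g :=
  (if_neg (by decide) : (if Multiplicative.ofAdd (1 : ZMod 2) = 1 then 1 else g) = g)

lemma R0_mul_self : R0 * R0 = 1 := by
  rw [R0, ← map_mul, mul_self_eq_one_of_zmod_two, map_one]

lemma R2_mul_self : R2 * R2 = 1 := by
  rw [R2, ← map_mul, mul_self_eq_one_of_zmod_two, map_one]

lemma R1_mul_self : R1 * R1 = 1 := by
  rw [R1, ← map_mul, show Multiplicative.ofAdd (1 : ZMod 2) * Multiplicative.ofAdd 1 = 1 by decide,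
    map_one]

lemma R0_mul_R2 : R0 * R2 = R2 * R0 := by
  simp only [R0, R2, ← map_mul Monoid.Coprod.inl, mul_comm]

/-- The homomorphism sending the two free generators to `S` and `S'`. -/
def freeToΓ : FreeGroup (Fin 2) →* Γ :=
  FreeGroup.lift ![R1 * R2, R0 * R1 * R2 * R0]

lemma freeToΓ_of_zero : freeToΓ (FreeGroup.of 0) = R1 * R2 := FreeGroup.lift_apply_of

lemma freeToΓ_of_one : freeToΓ (FreeGroup.of 1) = R0 * R1 * R2 * R0 := FreeGroup.lift_apply_of

lemma semidirect_R1_mul_self :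
    (⟨FreeGroup.of 0, Multiplicative.ofAdd (0, 1)⟩ : FreeGroup (Fin 2) ⋊[swapInv] _) *
      ⟨FreeGroup.of 0, Multiplicative.ofAdd (0, 1)⟩ = 1 := by
  refine SemidirectProduct.ext ?_ ?_
  · simp [swapInv_apply_of]
  · exact mul_self_eq_one_of_zmod_two _

/-- The homomorphism from `Γ` to the semidirect product sending `R0`, `R2` to the generators of
the complement and `R1` to `S * R2`. -/
def ΓToSemidirect : Γ →* FreeGroup (Fin 2) ⋊[swapInv] Multiplicative (ZMod 2 × ZMod 2) :=
  Monoid.Coprod.lift SemidirectProduct.inr (zmodTwoLift _ semidirect_R1_mul_self)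

lemma ΓToSemidirect_R0 :
    ΓToSemidirect R0 = SemidirectProduct.inr (Multiplicative.ofAdd (1, 0)) :=
  Monoid.Coprod.lift_apply_inl _ _ _

lemma ΓToSemidirect_R2 :
    ΓToSemidirect R2 = SemidirectProduct.inr (Multiplicative.ofAdd (0, 1)) :=
  Monoid.Coprod.lift_apply_inl _ _ _

lemma ΓToSemidirect_R1 :
    ΓToSemidirect R1 = ⟨FreeGroup.of 0, Multiplicative.ofAdd (0, 1)⟩ :=
  (Monoid.Coprod.lift_apply_inr _ _ _).trans (zmodTwoLift_ofAdd_one _ _)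

lemma ΓToSemidirect_S : ΓToSemidirect (R1 * R2) = SemidirectProduct.inl (FreeGroup.of 0) := by
  rw [map_mul, ΓToSemidirect_R1, ΓToSemidirect_R2]
  refine SemidirectProduct.ext ?_ ?_
  · simp
  · exact mul_self_eq_one_of_zmod_two _

lemma ΓToSemidirect_comp_freeToΓ : ΓToSemidirect.comp freeToΓ = SemidirectProduct.inl := by
  ext i : 1
  fin_cases i
  · exact (congrArg ΓToSemidirect freeToΓ_of_zero).trans ΓToSemidirect_S
  · refine (congrArg ΓToSemidirect freeToΓ_of_one).trans ?_
    rw [mul_assoc R0 R1 R2, map_mul, map_mul, ΓToSemidirect_S, ΓToSemidirect_R0]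
    refine SemidirectProduct.ext ?_ ?_
    · simp [swapInv_apply_of]
    · exact mul_self_eq_one_of_zmod_two _

lemma freeToΓ_injective : Function.Injective freeToΓ := by
  have h : Function.Injective (ΓToSemidirect.comp freeToΓ) := by
    rw [ΓToSemidirect_comp_freeToΓ]
    exact SemidirectProduct.inl_injective
  exact Function.Injective.of_comp (f := ΓToSemidirect) h

lemma freeToΓ_range : freeToΓ.range = Subgroup.closure {R1 * R2, R0 * R1 * R2 * R0} := by
  rw [freeToΓ, FreeGroup.range_lift_eq_closure, Matrix.range_cons_cons_empty]

lemma freeToΓ_conj (v : Multiplicative (ZMod 2 × ZMod 2)) :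
    freeToΓ.comp (swapInv v).toMonoidHom =
      (MulAut.conj (Monoid.Coprod.inl v : Γ)).toMonoidHom.comp freeToΓ := by
  have hv : v = 1 ∨ v = Multiplicative.ofAdd (1, 0) ∨ v = Multiplicative.ofAdd (0, 1) ∨
      v = Multiplicative.ofAdd (1, 0) * Multiplicative.ofAdd (0, 1) := by decide +revert
  have h0 : R0⁻¹ = R0 := inv_eq_of_mul_eq_one_left R0_mul_self
  have h1 : R1⁻¹ = R1 := inv_eq_of_mul_eq_one_left R1_mul_self
  have h2 : R2⁻¹ = R2 := inv_eq_of_mul_eq_one_left R2_mul_self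
  have hR0 : freeToΓ.comp (swapInv (Multiplicative.ofAdd (1, 0))).toMonoidHom =
      (MulAut.conj R0).toMonoidHom.comp freeToΓ := by
    refine FreeGroup.ext_hom _ _ (Fin.forall_fin_two.mpr ⟨?_, ?_⟩) <;>
      simp only [MonoidHom.comp_apply, MulEquiv.coe_toMonoidHom, MulAut.conj_apply]
    · simp [swapInv_apply_of, freeToΓ_of_zero, freeToΓ_of_one, h0, mul_assoc]
    · have h : Fin.rev (1 : Fin 2) = 0 := rfl
      simp only [swapInv_apply_of, toAdd_ofAdd, one_ne_zero, if_true, if_false, h, zpow_one,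
        freeToΓ_of_zero, freeToΓ_of_one, h0]
      calc R1 * R2 = (R0 * R0) * R1 * R2 * (R0 * R0) := by rw [R0_mul_self, one_mul, mul_one]
        _ = R0 * (R0 * R1 * R2 * R0) * R0 := by group
  have hR2 : freeToΓ.comp (swapInv (Multiplicative.ofAdd (0, 1))).toMonoidHom =
      (MulAut.conj R2).toMonoidHom.comp freeToΓ := by
    refine FreeGroup.ext_hom _ _ (Fin.forall_fin_two.mpr ⟨?_, ?_⟩) <;>
      simp only [MonoidHom.comp_apply, MulEquiv.coe_toMonoidHom, MulAut.conj_apply]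
    · simp [swapInv_apply_of, freeToΓ_of_zero, h1, h2, mul_assoc, R2_mul_self]
    · simp only [swapInv_apply_of, toAdd_ofAdd, if_true, one_ne_zero, if_false, zpow_neg, zpow_one,
        map_inv, freeToΓ_of_one, h0, h1, h2, mul_inv_rev]
      calc R0 * (R2 * (R1 * R0)) = (R0 * R2) * R1 * R0 := by group
        _ = (R2 * R0) * R1 * (R2 * R2) * R0 := by rw [R0_mul_R2, R2_mul_self, mul_one]
        _ = R2 * R0 * R1 * R2 * (R2 * R0) := by group
        _ = R2 * R0 * R1 * R2 * (R0 * R2) := by rw [R0_mul_R2]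
        _ = R2 * (R0 * R1 * R2 * R0) * R2 := by group
  rcases hv with rfl | rfl | rfl | rfl
  · ext i
    simp
  · exact hR0
  · exact hR2
  · refine MonoidHom.ext fun f => ?_
    have e0 (f) := DFunLike.congr_fun hR0 f
    have e2 (f) := DFunLike.congr_fun hR2 f
    simp only [MonoidHom.comp_apply, MulEquiv.coe_toMonoidHom] at e0 e2 ⊢
    rw [map_mul, map_mul, map_mul, MulAut.mul_apply, MulAut.mul_apply, e0, e2]
    rfl

/-- The homomorphism from the semidirect product back to `Γ`. -/
def semidirectToΓ : FreeGroup (Fin 2) ⋊[swapInv] Multiplicative (ZMod 2 × ZMod 2) →* Γ :=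
  SemidirectProduct.lift freeToΓ Monoid.Coprod.inl freeToΓ_conj

lemma semidirectToΓ_comp_ΓToSemidirect :
    semidirectToΓ.comp ΓToSemidirect = MonoidHom.id Γ := by
  refine Monoid.Coprod.hom_ext ?_ ?_
  · ext v
    simp [ΓToSemidirect, semidirectToΓ]
  · refine MonoidHom.ext fun x => ?_
    have hx : x = 1 ∨ x = Multiplicative.ofAdd 1 := by decide +revert
    rcases hx with rfl | rfl
    · simp
    · change semidirectToΓ (ΓToSemidirect R1) = R1
      rw [ΓToSemidirect_R1]
      change freeToΓ (FreeGroup.of 0) * R2 = R1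
      rw [freeToΓ_of_zero, mul_assoc, R2_mul_self, mul_one]

lemma freeToΓ_range_eq_ker :
    freeToΓ.range = (SemidirectProduct.rightHom.comp ΓToSemidirect).ker := by
  ext x
  constructor
  · rintro ⟨f, rfl⟩
    have h := DFunLike.congr_fun ΓToSemidirect_comp_freeToΓ f
    rw [MonoidHom.comp_apply] at h
    rw [MonoidHom.mem_ker, MonoidHom.comp_apply, h, SemidirectProduct.rightHom_inl]
  · intro hx
    have hx' : ΓToSemidirect x ∈ (SemidirectProduct.inl : _ →* _ ⋊[swapInv] _).range := by
      rw [SemidirectProduct.range_inl_eq_ker_rightHom]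
      exact hx
    obtain ⟨f, hf⟩ := hx'
    refine ⟨f, ?_⟩
    have h := DFunLike.congr_fun semidirectToΓ_comp_ΓToSemidirect x
    rw [MonoidHom.comp_apply, ← hf] at h
    simpa [semidirectToΓ] using h

lemma freeToΓ_range_index : freeToΓ.range.index = 4 := by
  have hsurj : Function.Surjective (SemidirectProduct.rightHom.comp ΓToSemidirect) := fun v =>
    ⟨Monoid.Coprod.inl v, by simp [ΓToSemidirect]⟩
  rw [freeToΓ_range_eq_ker, Subgroup.index_ker, MonoidHom.range_eq_top.mpr hsurj,
    Subgroup.card_top]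
  simp


/-- With `S = R1·R2` and `S' = R0·R1·R2·R0`, the subgroup of `Γ` generated by `S` and `S'`
is free of rank 2 with free basis `{S, S'}`: the homomorphism from the free group on two
generators to `Γ` sending the two generators to `S` and `S'` is injective, and its image,
the subgroup generated by `S` and `S'`, has index 4 in `Γ`.
(This is the parent group `N(5)` of Graver–Watkins.) -/
theorem stmt_5 :
    (∃ φ : FreeGroup (Fin 2) →* Γ,
      φ (FreeGroup.of 0) = R1 * R2 ∧
      φ (FreeGroup.of 1) = R0 * R1 * R2 * R0 ∧
      Function.Injective φ ∧
      φ.range = Subgroup.closure {R1 * R2, R0 * R1 * R2 * R0}) ∧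
    (Subgroup.closure {R1 * R2, R0 * R1 * R2 * R0} : Subgroup Γ).index = 4 := by
  exact ⟨⟨freeToΓ, freeToΓ_of_zero, freeToΓ_of_one, freeToΓ_injective, freeToΓ_range⟩,
    freeToΓ_range ▸ freeToΓ_range_index⟩
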